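/- Fix an integer n ≥ 3. There exists a valid configuration x of the tileset τ_σ on BS(1,n) such that x_{b g} = x_g for all g ∈ BS(1,n). In particular, the set of valid configurations of τ_σ is nonempty and contains a weakly periodic configuration (one fixed by the translation by b). -/

import Mathlib

/-- The Baumslag–Solitar relation `b a^m b⁻¹ (a^n)⁻¹` in the free group on two generators. -/
def BSrel (m n : ℤ) : Set (FreeGroup (Fin 2)) :=
  {FreeGroup.of 1 * FreeGroup.of 0 ^ m * (FreeGroup.of 1)⁻¹ * (FreeGroup.of 0 ^ n)⁻¹}

/-- The Baumslag–Solitar group `BS(m,n) = ⟨a, b ∣ b a^m b⁻¹ = a^n⟩`. -/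
abbrev BS (m n : ℤ) : Type := PresentedGroup (BSrel m n)

/-- The generator `a` of `BS(m,n)`. -/
def BSa (m n : ℤ) : BS m n := PresentedGroup.of 0

/-- The generator `b` of `BS(m,n)`. -/
def BSb (m n : ℤ) : BS m n := PresentedGroup.of 1

/-- The letter at position `i` (indexed from `0`) of the length-`n` word `σ_r(c)`,
where `σ_r(0) = 0^{n-r-1} 1 0^r` and `σ_r(1) = 0^n`: it is `1` iff `c = 0` and
`i = n - 1 - r`. -/
def sigmaLetter (n r : ℕ) (c : Fin 2) (i : ℕ) : Fin 2 :=
  if c = 0 ∧ i = n - 1 - r then 1 else 0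

/-- A valid configuration of the tileset `τ_σ` on `BS(1,n)`: a map
`x : BS(1,n) → {0,1} × {0,…,n−1}`, `x g = (c_g, i_g)`, such that for every `g`:
(i) `i_{ga} = i_g`, and (ii) for every `l ∈ {1,…,n}`, `c_g = σ_{i_h}(c_h)_{l−1}` where
`h = g a^{1−l} b`. -/
def ValidConfig (n : ℕ) (x : BS 1 (n : ℤ) → Fin 2 × Fin n) : Prop :=
  ∀ g : BS 1 (n : ℤ),
    (x (g * BSa 1 (n : ℤ))).2 = (x g).2 ∧
    ∀ l : ℕ, 1 ≤ l → l ≤ n →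
      (x g).1 =
        sigmaLetter n ((x (g * BSa 1 (n : ℤ) ^ (1 - (l : ℤ)) * BSb 1 (n : ℤ))).2 : ℕ)
          ((x (g * BSa 1 (n : ℤ) ^ (1 - (l : ℤ)) * BSb 1 (n : ℤ))).1) (l - 1)

/-- A sequence on `ℤ` fixed by the substitution placing its letter at position `1`: it satisfies
`R (n m + 1) = 1 - R m` and vanishes outside the residue class of `1` modulo `n`. -/
def fixedSeq (n : ℕ) (m : ℤ) : Fin 2 :=
  if _h : 3 ≤ n ∧ m % n = 1 then (if fixedSeq n (m / n) = 0 then 1 else 0) else 0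
termination_by m.natAbs
decreasing_by
  obtain ⟨hn, hm⟩ := _h
  have hdiv := Int.mul_ediv_add_emod m n
  rw [hm] at hdiv
  generalize m / (n : ℤ) = k at *
  subst hdiv
  rcases lt_trichotomy k 0 with hk | rfl | hk
  · have : (n : ℤ) * k ≤ 3 * k :=
      mul_le_mul_of_nonpos_right (by exact_mod_cast hn) hk.le
    omega
  · simp
  · have : 3 * k ≤ (n : ℤ) * k :=
      mul_le_mul_of_nonneg_right (by exact_mod_cast hn) hk.le
    omega

theorem fixedSeq_mul_add_one {n : ℕ} (hn : 3 ≤ n) (m : ℤ) :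
    fixedSeq n (n * m + 1) = if fixedSeq n m = 0 then 1 else 0 := by
  have hmod : ((n : ℤ) * m + 1) % n = 1 := by
    rw [Int.mul_add_emod_self_left]
    exact Int.emod_eq_of_lt (by norm_num) (by omega)
  have hdiv : ((n : ℤ) * m + 1) / n = m := by
    rw [Int.mul_add_ediv_left _ _ (by omega), Int.ediv_eq_zero_of_lt (by norm_num) (by omega),
      add_zero]
  rw [fixedSeq, dif_pos ⟨hn, hmod⟩, hdiv]

theorem fixedSeq_eq_zero {n : ℕ} {m : ℤ} (h : ¬ (n : ℤ) ∣ m - 1) : fixedSeq n m = 0 := by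
  rw [fixedSeq, dif_neg]
  rintro ⟨-, hm⟩
  exact h (hm ▸ Int.dvd_self_sub_emod)

/-- The substitution rule for `fixedSeq`, read from an arbitrary offset. -/
theorem fixedSeq_eq_sigmaLetter {n : ℕ} (hn : 3 ≤ n) (m : ℤ) {i j : ℕ} (hi : i < n)
    (hj : j < n) :
    fixedSeq n (n * m + i + j + 2 - n) = sigmaLetter n i (fixedSeq n m) j := by
  unfold sigmaLetter
  by_cases h : j = n - 1 - i
  · have : (n : ℤ) * m + i + j + 2 - n = n * m + 1 := by omega
    rw [this, fixedSeq_mul_add_one hn]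
    simp [h]
  · rw [if_neg (fun h' => h h'.2)]
    apply fixedSeq_eq_zero
    rintro ⟨k, hk⟩
    have hd : (n : ℤ) ∣ i + j + 1 - n := ⟨k - m, by linear_combination hk⟩
    have := Int.eq_zero_of_abs_lt_dvd hd (abs_lt.2 ⟨by omega, by omega⟩)
    omega

/-- The floor function with offset `(n - 2) / (n - 1)`. -/
def offsetFloor (n : ℕ) (v : ℚ) : ℤ := ⌊v + (n - 2) / (n - 1)⌋

theorem offsetFloor_add_int (n : ℕ) (v : ℚ) (j : ℤ) :
    offsetFloor n (v + j) = offsetFloor n v + j := by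
  rw [offsetFloor, add_right_comm, Int.floor_add_intCast, offsetFloor]

theorem offsetFloor_mul_bounds {n : ℕ} (hn : 3 ≤ n) (v : ℚ) :
    n * offsetFloor n v + 2 - n ≤ offsetFloor n (n * v) ∧
      offsetFloor n (n * v) ≤ n * offsetFloor n v + 1 := by
  have hn' : (3 : ℚ) ≤ n := by exact_mod_cast hn
  have hα : ((n : ℚ) - 2) / (n - 1) * (n - 1) = n - 2 := div_mul_cancel₀ _ (by linarith)
  have h₁ := Int.floor_le (v + ((n : ℚ) - 2) / (n - 1))
  have h₂ := Int.lt_floor_add_one (v + ((n : ℚ) - 2) / (n - 1))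
  unfold offsetFloor
  generalize ((n : ℚ) - 2) / (n - 1) = α at *
  generalize ⌊v + α⌋ = N at *
  constructor
  · rw [Int.le_floor]
    push_cast
    nlinarith
  · rw [← Int.lt_add_one_iff, Int.floor_lt]
    push_cast
    nlinarith

/-- The index of the substitution applied along the coset of `v` modulo `ℤ`. -/
def substIndex (n : ℕ) (v : ℚ) : ℕ :=
  (offsetFloor n (n * v) + n - 2 - n * offsetFloor n v).toNat

theorem substIndex_cast {n : ℕ} (hn : 3 ≤ n) (v : ℚ) :
    (substIndex n v : ℤ) = offsetFloor n (n * v) + n - 2 - n * offsetFloor n v :=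
  Int.toNat_of_nonneg (by have := (offsetFloor_mul_bounds hn v).1; omega)

theorem substIndex_lt {n : ℕ} (hn : 3 ≤ n) (v : ℚ) : substIndex n v < n := by
  have := substIndex_cast hn v
  have := (offsetFloor_mul_bounds hn v).2
  omega

theorem substIndex_add_one (n : ℕ) (v : ℚ) : substIndex n (v + 1) = substIndex n v := by
  have h₁ := offsetFloor_add_int n v 1
  have h₂ := offsetFloor_add_int n (n * v) n
  rw [Int.cast_one] at h₁
  rw [Int.cast_natCast] at h₂
  rw [substIndex, mul_add, mul_one, h₁, h₂, substIndex]
  congr 1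
  ring

theorem fixedSeq_offsetFloor {n : ℕ} (hn : 3 ≤ n) (v : ℚ) {j : ℕ} (hj : j < n) :
    fixedSeq n (offsetFloor n (n * v + j)) =
      sigmaLetter n (substIndex n v) (fixedSeq n (offsetFloor n v)) j := by
  rw [← fixedSeq_eq_sigmaLetter hn _ (substIndex_lt hn v) hj, substIndex_cast hn]
  have := offsetFloor_add_int n (n * v) j
  rw [Int.cast_natCast] at this
  rw [this]
  congr 1
  ring

/-- The action of `BS(1,n)` on `ℚ` with `a` acting by `t ↦ t + 1` and `b` by `t ↦ n t`. -/
def bsAction (n : ℕ) (hn : (n : ℚ) ≠ 0) : BS 1 (n : ℤ) →* Equiv.Perm ℚ :=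
  PresentedGroup.toGroup (f := ![Equiv.addRight 1, Equiv.mulLeft₀ (n : ℚ) hn]) (by
    rintro _ rfl
    ext t
    simp [mul_add, hn])

theorem bsAction_a (n : ℕ) (hn : (n : ℚ) ≠ 0) :
    bsAction n hn (BSa 1 n) = Equiv.addRight 1 :=
  PresentedGroup.toGroup.of _

theorem bsAction_b (n : ℕ) (hn : (n : ℚ) ≠ 0) :
    bsAction n hn (BSb 1 n) = Equiv.mulLeft₀ (n : ℚ) hn :=
  PresentedGroup.toGroup.of _

/-- The coordinate `-(g⁻¹ • 0)` of `g`, invariant under left multiplication by `b`. -/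
def bsCoord (n : ℕ) (hn : (n : ℚ) ≠ 0) (g : BS 1 (n : ℤ)) : ℚ := -(bsAction n hn g)⁻¹ 0

theorem bsCoord_mul_a_zpow (n : ℕ) (hn : (n : ℚ) ≠ 0) (g : BS 1 (n : ℤ)) (j : ℤ) :
    bsCoord n hn (g * BSa 1 n ^ j) = bsCoord n hn g + j := by
  simp only [bsCoord, map_mul, map_zpow, bsAction_a, mul_inv_rev, ← zpow_neg,
    Equiv.Perm.mul_apply]
  simp
  ring

theorem mul_bsCoord_mul_b (n : ℕ) (hn : (n : ℚ) ≠ 0) (g : BS 1 (n : ℤ)) :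
    n * bsCoord n hn (g * BSb 1 n) = bsCoord n hn g := by
  simp only [bsCoord, map_mul, bsAction_b, mul_inv_rev, Equiv.Perm.mul_apply]
  simp [hn]

theorem bsCoord_b_mul (n : ℕ) (hn : (n : ℚ) ≠ 0) (g : BS 1 (n : ℤ)) :
    bsCoord n hn (BSb 1 n * g) = bsCoord n hn g := by
  simp only [bsCoord, map_mul, bsAction_b, mul_inv_rev, Equiv.Perm.mul_apply]
  simp

/-- For `n ≥ 3`, there is a valid configuration of `τ_σ` on `BS(1,n)` that is fixed by
translation by `b`; in particular the set of valid configurations is nonempty and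
contains a weakly periodic configuration. -/
theorem exists_b_periodic_valid_config (n : ℕ) (hn : 3 ≤ n) :
    ∃ x : BS 1 (n : ℤ) → Fin 2 × Fin n, ValidConfig n x ∧
      ∀ g : BS 1 (n : ℤ), x (BSb 1 (n : ℤ) * g) = x g := by
  have hn₀ : (n : ℚ) ≠ 0 := by
    have : n ≠ 0 := by omega
    exact_mod_cast this
  refine ⟨fun g => (fixedSeq n (offsetFloor n (bsCoord n hn₀ g)),
    ⟨substIndex n (bsCoord n hn₀ g), substIndex_lt hn _⟩), fun g => ⟨?_, fun l hl hln => ?_⟩,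
    fun g => ?_⟩
  · have h := bsCoord_mul_a_zpow n hn₀ g 1
    rw [zpow_one, Int.cast_one] at h
    simp only [h, substIndex_add_one]
  · have hj : l - 1 < n := by omega
    have h := mul_bsCoord_mul_b n hn₀ (g * BSa 1 n ^ (1 - (l : ℤ)))
    rw [bsCoord_mul_a_zpow] at h
    rw [← fixedSeq_offsetFloor hn _ hj, h]
    change fixedSeq n (offsetFloor n _) = _
    congr 2
    push_cast [hl]
    ring
  · simp only [bsCoord_b_mul]
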